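/- arXiv:1508.01110 — 4 statements merged into one kernel-verified Lean document; each statement's English description precedes it below -/
import Mathlib

section
/- Let K be a field, m a positive integer, and U_1, ..., U_m nonzero vector spaces over K. Suppose ψ_i : U_i → U_i are linear automorphisms such that ψ_1 ⊗ ... ⊗ ψ_m is the identity map of U_1 ⊗ ... ⊗ U_m. Then there exist scalars λ_1, ..., λ_m ∈ K^× such that ψ_i = λ_i · id_{U_i} for every i, and λ_1 · λ_2 · ... · λ_m = 1. -/
open scoped TensorProduct

open PiTensorProduct in
/-- If `ψ₁ ⊗ ⋯ ⊗ ψₘ` is the identity, then pairing it with decomposable tensors of functionals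
gives the same value before and after applying the `ψᵢ`. -/
theorem prod_dual_apply_eq_of_map_eq_id {K ι : Type*} [Field K] [Fintype ι] {U : ι → Type*}
    [∀ i, AddCommGroup (U i)] [∀ i, Module K (U i)] {ψ : ∀ i, U i →ₗ[K] U i}
    (h : PiTensorProduct.map ψ = LinearMap.id) (g : ∀ i, Module.Dual K (U i)) (x : ∀ i, U i) :
    ∏ i, g i (ψ i (x i)) = ∏ i, g i (x i) := by
  have hx : tprod K (fun i => ψ i (x i)) = tprod K x := by
    rw [← map_tprod, h, LinearMap.id_apply]
  simpa using congrArg (lift ((MultilinearMap.mkPiAlgebra K ι K).compLinearMap g)) hx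

theorem exists_dual_apply_eq_one {K V : Type*} [Field K] [AddCommGroup V] [Module K V] {v : V}
    (hv : v ≠ 0) : ∃ f : Module.Dual K V, f v = 1 := by
  obtain ⟨f, hf⟩ : ∃ f : Module.Dual K V, f v ≠ 0 := by
    by_contra! hf
    exact hv ((Module.forall_dual_apply_eq_zero_iff K v).1 hf)
  exact ⟨(f v)⁻¹ • f, by simp [hf]⟩

/-- If `ψ_1 ⊗ ... ⊗ ψ_m` is the identity of `U_1 ⊗ ... ⊗ U_m` (all `U_i` nonzero), then
each `ψ_i` is multiplication by a scalar `λ_i ∈ K^×`, and `λ_1 ⋯ λ_m = 1`. -/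
theorem tensor_of_automorphisms_eq_id (K : Type*) [Field K] (m : ℕ) (hm : 0 < m)
    (U : Fin m → Type*) [∀ i, AddCommGroup (U i)] [∀ i, Module K (U i)]
    [∀ i, Nontrivial (U i)] (ψ : ∀ i, U i ≃ₗ[K] U i)
    (h : PiTensorProduct.map (fun i => (ψ i).toLinearMap) = LinearMap.id) :
    ∃ lam : Fin m → Kˣ,
      (∀ i, ∀ u : U i, ψ i u = (lam i : K) • u) ∧ (∏ i, lam i) = 1 := by
  classical
  have key := prod_dual_apply_eq_of_map_eq_id h
  simp only [LinearEquiv.coe_coe] at key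
  choose v hv using fun i => exists_ne (0 : U i)
  have hψv : ∀ i, ψ i (v i) ≠ 0 := fun i => (ψ i).map_ne_zero_iff.2 (hv i)
  choose f hf using fun i => exists_dual_apply_eq_one (K := K) (hψv i)
  let c : Fin m → K := fun i => ∏ j ∈ Finset.univ.erase i, f j (v j)
  have hc : ∀ i (u : U i), ψ i u = c i • u := by
    intro i u
    rw [← sub_eq_zero, ← Module.forall_dual_apply_eq_zero_iff K]
    intro g
    have hg := key (Function.update f i g) (Function.update v i u)
    rw [← Finset.mul_prod_erase _ _ (Finset.mem_univ i),
      ← Finset.mul_prod_erase _ _ (Finset.mem_univ i)] at hg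
    have hl : ∏ j ∈ Finset.univ.erase i,
        Function.update f i g j (ψ j (Function.update v i u j)) = 1 :=
      Finset.prod_eq_one fun j hj => by simp [Finset.ne_of_mem_erase hj, hf]
    have hr : ∏ j ∈ Finset.univ.erase i,
        Function.update f i g j (Function.update v i u j) = c i :=
      Finset.prod_congr rfl fun j hj => by simp [Finset.ne_of_mem_erase hj]
    rw [hl, hr] at hg
    simp only [Function.update_self, mul_one] at hg
    rw [map_sub, map_smul, hg, smul_eq_mul, mul_comm, sub_self]
  have hc0 : ∀ i, c i ≠ 0 := fun i h0 => hψv i (by rw [hc, h0, zero_smul])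
  refine ⟨fun i => Units.mk0 (c i) (hc0 i), hc, Units.ext ?_⟩
  have hfv : ∏ i, f i (v i) = 1 := by simpa [hf] using (key f v).symm
  have hprod : ∏ i, c i * f i (v i) = 1 :=
    Finset.prod_eq_one fun i _ => by rw [← smul_eq_mul, ← map_smul, ← hc, hf]
  simpa [Finset.prod_mul_distrib, hfv] using hprod
end

section
/- Let K be a field and m, n, p positive integers, and let a ∈ GL_m(K), b ∈ GL_n(K), c ∈ GL_p(K). Then T(a,b,c) is the identity map of M_{m×n}(K) ⊗ M_{n×p}(K) ⊗ M_{p×m}(K) if and only if a, b, and c are all nonzero scalar matrices (a = λ·E_m, b = μ·E_n, c = ν·E_p for some λ, μ, ν ∈ K^×). -/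
open scoped TensorProduct MatrixGroups
open Matrix

/-- The linear map `x ↦ a * x * b` on spaces of rectangular matrices. -/
def sandwich {K : Type*} [Field K] {m n : ℕ} (a : Matrix (Fin m) (Fin m) K)
    (b : Matrix (Fin n) (Fin n) K) :
    Matrix (Fin m) (Fin n) K →ₗ[K] Matrix (Fin m) (Fin n) K where
  toFun x := a * x * b
  map_add' x y := by simp only [Matrix.mul_add, Matrix.add_mul]
  map_smul' c x := by simp only [RingHom.id_apply, Matrix.mul_smul, Matrix.smul_mul]

/-- The transformation `T(a,b,c) : x ⊗ y ⊗ z ↦ a x b⁻¹ ⊗ b y c⁻¹ ⊗ c z a⁻¹`. -/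
noncomputable def Tabc {K : Type*} [Field K] {m n p : ℕ}
    (a : GL (Fin m) K) (b : GL (Fin n) K) (c : GL (Fin p) K) :
    TensorProduct K (Matrix (Fin m) (Fin n) K)
        (TensorProduct K (Matrix (Fin n) (Fin p) K) (Matrix (Fin p) (Fin m) K)) →ₗ[K]
      TensorProduct K (Matrix (Fin m) (Fin n) K)
        (TensorProduct K (Matrix (Fin n) (Fin p) K) (Matrix (Fin p) (Fin m) K)) :=
  TensorProduct.map (sandwich (↑a) (↑(b⁻¹)))
    (TensorProduct.map (sandwich (↑b) (↑(c⁻¹))) (sandwich (↑c) (↑(a⁻¹))))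

theorem TensorProduct.tmul_ne_zero_of_field {K V W : Type*} [Field K]
    [AddCommGroup V] [Module K V] [AddCommGroup W] [Module K W]
    {x : V} {y : W} (hx : x ≠ 0) (hy : y ≠ 0) : x ⊗ₜ[K] y ≠ 0 := by
  obtain ⟨φ, hφ⟩ := Module.Projective.exists_dual_ne_zero K hx
  intro h
  have := congrArg ((TensorProduct.lid K W).toLinearMap ∘ₗ φ.rTensor W) h
  simp [hφ, hy] at this

theorem TensorProduct.eq_smul_id_of_map_eq_smul_id {K V W : Type*} [Field K]
    [AddCommGroup V] [Module K V] [AddCommGroup W] [Module K W] [Nontrivial V] [Nontrivial W]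
    {f : V →ₗ[K] V} {g : W →ₗ[K] W} {s : K} (hs : s ≠ 0)
    (h : TensorProduct.map f g = s • LinearMap.id) :
    (∃ t : K, t ≠ 0 ∧ f = t • LinearMap.id) ∧ ∃ t : K, t ≠ 0 ∧ g = t • LinearMap.id := by
  have key (x : V) (y : W) : f x ⊗ₜ[K] g y = s • (x ⊗ₜ[K] y) := by
    simpa using LinearMap.congr_fun h (x ⊗ₜ[K] y)
  have hne (x : V) (y : W) (hx : x ≠ 0) (hy : y ≠ 0) : f x ≠ 0 ∧ g y ≠ 0 := by
    have hxy : f x ⊗ₜ[K] g y ≠ 0 := by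
      rw [key]
      exact smul_ne_zero hs (TensorProduct.tmul_ne_zero_of_field hx hy)
    constructor <;> intro h0 <;> simp [h0] at hxy
  obtain ⟨x, hx⟩ := exists_ne (0 : V)
  obtain ⟨y, hy⟩ := exists_ne (0 : W)
  constructor
  · obtain ⟨φ, hφ⟩ := Module.Projective.exists_dual_ne_zero K (hne x y hx hy).2
    have hf (v : V) : f v = ((φ (g y))⁻¹ * (s * φ y)) • v := by
      have := congrArg ((TensorProduct.rid K V).toLinearMap ∘ₗ φ.lTensor V) (key v y)
      simp only [LinearMap.comp_apply, map_smul, LinearMap.lTensor_tmul, LinearEquiv.coe_coe,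
        TensorProduct.rid_tmul] at this
      rw [mul_smul, mul_smul, ← this, inv_smul_smul₀ hφ]
    exact ⟨_, fun h0 => (hne x y hx hy).1 (by rw [hf, h0, zero_smul]), LinearMap.ext hf⟩
  · obtain ⟨φ, hφ⟩ := Module.Projective.exists_dual_ne_zero K (hne x y hx hy).1
    have hg (w : W) : g w = ((φ (f x))⁻¹ * (s * φ x)) • w := by
      have := congrArg ((TensorProduct.lid K W).toLinearMap ∘ₗ φ.rTensor W) (key x w)
      simp only [LinearMap.comp_apply, map_smul, LinearMap.rTensor_tmul, LinearEquiv.coe_coe,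
        TensorProduct.lid_tmul] at this
      rw [mul_smul, mul_smul, ← this, inv_smul_smul₀ hφ]
    exact ⟨_, fun h0 => (hne x y hx hy).2 (by rw [hg, h0, zero_smul]), LinearMap.ext hg⟩

theorem exists_eq_smul_one_of_sandwich_eq_smul_id {K : Type*} [Field K] {m n : ℕ}
    (hm : 0 < m) (hn : 0 < n) (a : GL (Fin m) K) (b : GL (Fin n) K) {t : K}
    (h : sandwich a.val (b⁻¹).val =
      t • LinearMap.id) :
    ∃ lam : Kˣ, a.val = (lam : K) • 1 := by
  have : NeZero m := ⟨hm.ne'⟩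
  have hmul (x : Matrix (Fin m) (Fin n) K) : a.val * x = t • (x * b.val) := by
    have hx : a.val * x * (b⁻¹).val = t • x :=
      LinearMap.congr_fun h x
    rw [← Matrix.smul_mul, ← hx, Matrix.mul_assoc, ← Units.val_mul, inv_mul_cancel, Units.val_one,
      Matrix.mul_one]
  let j : Fin n := ⟨0, hn⟩
  have ha : a.val = (t * b.val j j) • 1 := by
    ext k i
    have hki := congrFun (congrFun (hmul (Matrix.single i j 1)) k) j
    by_cases hik : k = i
    · subst hik
      simpa using hki
    · simpa [hik, Matrix.single_mul_apply_of_ne _ _ _ _ _ hik] using hki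
  have h0 : t * b.val j j ≠ 0 := fun h0 => a.ne_zero (by rw [ha, h0, zero_smul])
  exact ⟨Units.mk0 _ h0, ha⟩

theorem sandwich_eq_smul_id {K : Type*} [Field K] {m n : ℕ} (a : GL (Fin m) K) (b : GL (Fin n) K)
    {lam mu : Kˣ} (ha : a.val = (lam : K) • 1)
    (hb : b.val = (mu : K) • 1) :
    sandwich a.val (b⁻¹).val =
      ((lam : K) * (mu : K)⁻¹) • LinearMap.id := by
  have hb' : (b⁻¹).val = (mu : K)⁻¹ • 1 := by
    apply Units.inv_eq_of_mul_eq_one_right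
    rw [hb, Matrix.smul_mul, Matrix.one_mul, smul_smul, mul_inv_cancel₀ mu.ne_zero, one_smul]
  refine LinearMap.ext fun x => ?_
  change a.val * x * (b⁻¹).val = _
  simp [ha, hb', smul_smul, mul_comm]

/-- `T(a,b,c)` is the identity iff `a`, `b`, `c` are nonzero scalar matrices. -/
theorem Tabc_eq_id_iff_scalar (K : Type*) [Field K] (m n p : ℕ)
    (hm : 0 < m) (hn : 0 < n) (hp : 0 < p)
    (a : GL (Fin m) K) (b : GL (Fin n) K) (c : GL (Fin p) K) :
    Tabc a b c = LinearMap.id ↔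
      ∃ (lam mu nu : Kˣ),
        (↑a : Matrix (Fin m) (Fin m) K) = (lam : K) • (1 : Matrix (Fin m) (Fin m) K) ∧
        (↑b : Matrix (Fin n) (Fin n) K) = (mu : K) • (1 : Matrix (Fin n) (Fin n) K) ∧
        (↑c : Matrix (Fin p) (Fin p) K) = (nu : K) • (1 : Matrix (Fin p) (Fin p) K) := by
  have : NeZero m := ⟨hm.ne'⟩
  have : NeZero n := ⟨hn.ne'⟩
  have : NeZero p := ⟨hp.ne'⟩
  have : Nontrivial (Matrix (Fin n) (Fin p) K ⊗[K] Matrix (Fin p) (Fin m) K) := by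
    obtain ⟨y, hy⟩ := exists_ne (0 : Matrix (Fin n) (Fin p) K)
    obtain ⟨z, hz⟩ := exists_ne (0 : Matrix (Fin p) (Fin m) K)
    exact ⟨y ⊗ₜ z, 0, TensorProduct.tmul_ne_zero_of_field hy hz⟩
  constructor
  · intro h
    obtain ⟨⟨r, -, ha⟩, s, hs, hbc⟩ := TensorProduct.eq_smul_id_of_map_eq_smul_id one_ne_zero
      (h.trans (one_smul K LinearMap.id).symm)
    obtain ⟨⟨t, -, hb⟩, u, -, hc⟩ := TensorProduct.eq_smul_id_of_map_eq_smul_id hs hbc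
    obtain ⟨lam, hlam⟩ := exists_eq_smul_one_of_sandwich_eq_smul_id hm hn a b ha
    obtain ⟨mu, hmu⟩ := exists_eq_smul_one_of_sandwich_eq_smul_id hn hp b c hb
    obtain ⟨nu, hnu⟩ := exists_eq_smul_one_of_sandwich_eq_smul_id hp hm c a hc
    exact ⟨lam, mu, nu, hlam, hmu, hnu⟩
  · rintro ⟨lam, mu, nu, ha, hb, hc⟩
    have hprod : (lam : K) * (mu : K)⁻¹ * (mu * (nu : K)⁻¹ * (nu * (lam : K)⁻¹)) = 1 := by
      field_simp
    rw [Tabc, sandwich_eq_smul_id a b ha hb, sandwich_eq_smul_id b c hb hc,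
      sandwich_eq_smul_id c a hc ha]
    simp only [TensorProduct.map_smul_left, TensorProduct.map_smul_right, TensorProduct.map_id,
      smul_smul]
    convert one_smul K _ using 2
    rw [← hprod]
    ring
end

section
/- Let K be a field, X and Y finite-dimensional vector spaces over K, and 𝓛 = Hom_K(X,Y). For a subspace L ⊆ 𝓛 define Ker L = ⋂_{f ∈ L} ker f, im L = Σ_{f ∈ L} range f, and the type β(L) = (dim X − dim Ker L, dim im L). Suppose h : 𝓛 → 𝓛 is a linear map such that β(h(L)) = β(L) for every subspace L ⊆ 𝓛 (where h(L) denotes the image of L under h). Then there exist linear automorphisms a of X and b of Y such that h(f) = b ∘ f ∘ a for every f ∈ 𝓛. -/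
open Module LinearMap

section Helpers

variable {K X Y : Type*} [Field K] [AddCommGroup X] [Module K X] [AddCommGroup Y] [Module K Y]

/-- Linear maps on `Hom_K(X,Y)` are determined by their values on maps of rank at most one. -/
lemma LinearMap.ext_smulRight [FiniteDimensional K X] {Z : Type*} [AddCommGroup Z] [Module K Z]
    {g h : (X →ₗ[K] Y) →ₗ[K] Z}
    (H : ∀ (φ : Dual K X) (y : Y), g (φ.smulRight y) = h (φ.smulRight y)) : g = h := by
  ext f
  let e := finBasis K X
  have hf : f = ∑ i, (e.coord i).smulRight (f (e i)) := by
    refine e.ext fun j => ?_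
    simp [Finsupp.single_apply]
  rw [hf, map_sum, map_sum]
  exact Finset.sum_congr rfl fun i _ => H _ _

/-- A linear map which is pointwise proportional to an injective one is a scalar multiple of it. -/
lemma LinearMap.exists_eq_smul_of_forall_apply_eq_smul [FiniteDimensional K Y] {g b : Y →ₗ[K] Y}
    (hb : Function.Injective b) (H : ∀ y, ∃ c : K, g y = c • b y) : ∃ c : K, g = c • b := by
  let b' := LinearEquiv.ofInjectiveEndo b hb
  have hb' : ∀ y, b'.symm (b y) = y := b'.symm_apply_apply
  obtain ⟨c, hc⟩ := exists_eq_smul_id_of_forall_notLinearIndependent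
    (f := b'.symm.toLinearMap ∘ₗ g) fun v => by
      obtain ⟨c, hc⟩ := H v
      rw [LinearIndependent.pair_iff]
      intro h
      have := (h c (-1) (by simp [hc, hb'])).2
      simp at this
  refine ⟨c, LinearMap.ext fun y => b'.symm.injective ?_⟩
  have := LinearMap.congr_fun hc y
  simpa [hb'] using this

/-- A subspace of dimension at most one lies in the span of one vector. -/
lemma Submodule.exists_le_span_singleton_of_finrank_le_one [FiniteDimensional K Y]
    (W : Submodule K Y) (hW : finrank K W ≤ 1) : ∃ v : Y, W ≤ K ∙ v := by
  obtain ⟨⟨v, hv⟩, h⟩ := finrank_le_one_iff.1 hW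
  refine ⟨v, fun w hw => Submodule.mem_span_singleton.2 ?_⟩
  obtain ⟨c, hc⟩ := h ⟨w, hw⟩
  exact ⟨c, congrArg Subtype.val hc⟩

/-- A subspace of codimension at most one contains the kernel of a linear form. -/
lemma Submodule.exists_ker_le_of_finrank_sub_le_one [FiniteDimensional K X] (W : Submodule K X)
    (hW : finrank K X - finrank K W ≤ 1) : ∃ ψ : Dual K X, LinearMap.ker ψ ≤ W := by
  have h1 : finrank K W.dualAnnihilator ≤ 1 := by
    have := Subspace.finrank_add_finrank_dualAnnihilator_eq W
    omega
  obtain ⟨ψ, hψ⟩ := Submodule.exists_le_span_singleton_of_finrank_le_one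
    (Y := Dual K X) W.dualAnnihilator h1
  refine ⟨ψ, fun x hx => ?_⟩
  rw [← Subspace.forall_mem_dualAnnihilator_apply_eq_zero_iff]
  intro η hη
  obtain ⟨c, rfl⟩ := Submodule.mem_span_singleton.1 (hψ hη)
  rw [LinearMap.smul_apply, LinearMap.mem_ker.1 hx, smul_zero]

/-- An injective endomorphism of the dual space is the transpose of an automorphism. -/
lemma Module.Dual.exists_linearEquiv_of_injective [FiniteDimensional K X]
    (A : Dual K X →ₗ[K] Dual K X) (hA : Function.Injective A) :
    ∃ a : X ≃ₗ[K] X, ∀ φ x, A φ x = φ (a x) := by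
  let A' := LinearEquiv.ofInjectiveEndo A hA
  refine ⟨(evalEquiv K X).trans (A'.dualMap.trans (evalEquiv K X).symm), fun φ x => ?_⟩
  have : A' φ = A φ := rfl
  simp [this]

variable [FiniteDimensional K X] [FiniteDimensional K Y]

/-- An injective `h` is a sandwich `f ↦ b ∘ f ∘ a` as soon as the maps `h (φ ⊗ y)` have their ranges
in a line depending only on `y` and vanish on the kernel of a form depending only on `φ`. -/
lemma LinearMap.exists_sandwich_of_injective (h : (X →ₗ[K] Y) →ₗ[K] (X →ₗ[K] Y))
    (hinj : Function.Injective h)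
    (hrange : ∀ y : Y, ∃ v : Y, ∀ φ : Dual K X, LinearMap.range (h (φ.smulRight y)) ≤ K ∙ v)
    (hker : ∀ φ : Dual K X, ∃ ψ : Dual K X, ∀ y : Y,
      LinearMap.ker ψ ≤ LinearMap.ker (h (φ.smulRight y))) :
    ∃ (a : X ≃ₗ[K] X) (b : Y ≃ₗ[K] Y),
      ∀ f : X →ₗ[K] Y, h f = b.toLinearMap ∘ₗ f ∘ₗ a.toLinearMap := by
  rcases subsingleton_or_nontrivial X with hX | hX
  · exact ⟨.refl K X, .refl K Y, fun f => LinearMap.ext fun x => by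
      simp [Subsingleton.elim x 0]⟩
  rcases subsingleton_or_nontrivial Y with hY | hY
  · exact ⟨.refl K X, .refl K Y, fun f => LinearMap.ext fun x => Subsingleton.elim _ _⟩
  have hne : ∀ (φ : Dual K X) (y : Y), φ ≠ 0 → y ≠ 0 → h (φ.smulRight y) ≠ 0 := by
    intro φ y hφ hy h0
    rw [map_eq_zero_iff h hinj] at h0
    refine hφ (LinearMap.ext fun x => ?_)
    simpa [hy] using LinearMap.congr_fun h0 x
  have hrange' : ∀ y : Y, ∃ v : Y, ∀ (φ : Dual K X) x, ∃ c : K, h (φ.smulRight y) x = c • v := by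
    intro y
    obtain ⟨v, hv⟩ := hrange y
    refine ⟨v, fun φ x => ?_⟩
    obtain ⟨c, hc⟩ := Submodule.mem_span_singleton.1 (hv φ (LinearMap.mem_range_self _ x))
    exact ⟨c, hc.symm⟩
  obtain ⟨y₀, hy₀⟩ := exists_ne (0 : Y)
  obtain ⟨φ₀, hφ₀⟩ := exists_ne (0 : Dual K X)
  obtain ⟨v₀, hv₀⟩ := hrange' y₀
  have hv₀0 : v₀ ≠ 0 := by
    rintro rfl
    refine hne φ₀ y₀ hφ₀ hy₀ (LinearMap.ext fun x => ?_)
    obtain ⟨c, hc⟩ := hv₀ φ₀ x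
    simpa using hc
  obtain ⟨η, hη⟩ : ∃ η : Dual K Y, η v₀ = 1 := by
    obtain ⟨η, hη⟩ := exists_dual_forall_apply_eq_one (ι := Unit) (v := fun _ => v₀)
      (s := {()}) (LinearIndepOn.singleton (R := K) hv₀0)
    exact ⟨η, hη _ rfl⟩
  let A : Dual K X →ₗ[K] Dual K X :=
    { toFun := fun φ => η ∘ₗ h (φ.smulRight y₀)
      map_add' := fun φ ψ => by
        rw [show (φ + ψ).smulRight y₀ = φ.smulRight y₀ + ψ.smulRight y₀ by ext; simp [add_smul],
          map_add, LinearMap.comp_add]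
      map_smul' := fun c φ => by
        rw [show (c • φ).smulRight y₀ = c • φ.smulRight y₀ by ext; simp [mul_smul],
          map_smul, LinearMap.comp_smul, RingHom.id_apply] }
  have hA : ∀ φ, h (φ.smulRight y₀) = (A φ).smulRight v₀ := by
    intro φ
    ext x
    obtain ⟨c, hc⟩ := hv₀ φ x
    simp [A, hc, hη]
  have hA0 : ∀ φ, φ ≠ 0 → A φ ≠ 0 := by
    intro φ hφ h0
    exact hne φ y₀ hφ hy₀ (by rw [hA, h0]; ext; simp)
  obtain ⟨a, ha⟩ := Dual.exists_linearEquiv_of_injective A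
    ((injective_iff_map_eq_zero A).2 fun φ hφ => by_contra fun h' => hA0 φ h' hφ)
  have hB : ∀ φ : Dual K X, φ ≠ 0 → ∃ B : Y →ₗ[K] Y,
      ∀ y, h (φ.smulRight y) = (A φ).smulRight (B y) := by
    intro φ hφ
    obtain ⟨ψ, hψ⟩ := hker φ
    have hAψ : LinearMap.ker ψ ≤ LinearMap.ker (A φ) := fun x hx => by
      have := hψ y₀ hx
      rw [hA] at this
      simpa [hv₀0] using this
    have hψA : LinearMap.ker (A φ) ≤ LinearMap.ker ψ := by
      obtain ⟨c, hc⟩ : ∃ c : K, c • ψ = A φ := by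
        have := FiniteDimensional.mem_span_of_iInf_ker_le_ker (L := fun _ : Unit => ψ)
          (K := A φ) (by simpa using hAψ)
        rwa [Set.range_const, Submodule.mem_span_singleton] at this
      have hc0 : c ≠ 0 := by
        rintro rfl
        exact hA0 φ hφ (by rw [← hc, zero_smul])
      intro x hx
      rw [← hc] at hx
      simpa [hc0] using hx
    obtain ⟨x₁, hx₁⟩ : ∃ x, A φ x = 1 := LinearMap.surjective (hA0 φ hφ) 1
    refine ⟨LinearMap.applyₗ x₁ ∘ₗ h ∘ₗ LinearMap.smulRightₗ φ, fun y => LinearMap.ext fun x => ?_⟩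
    have hx : x - A φ x • x₁ ∈ LinearMap.ker (A φ) := by simp [hx₁]
    have := hψ y (hψA hx)
    simpa [sub_eq_zero] using this
  obtain ⟨b, hb⟩ := hB φ₀ hφ₀
  have hb0 : ∀ y, y ≠ 0 → b y ≠ 0 := fun y hy h0 =>
    hne φ₀ y hφ₀ hy (by rw [hb, h0]; ext; simp)
  have hbinj : Function.Injective b :=
    (injective_iff_map_eq_zero b).2 fun y hy => by_contra fun h' => hb0 y h' hy
  have apply_y₀ : ∀ (φ : Dual K X) (B : Y →ₗ[K] Y), φ ≠ 0 →
      (∀ y, h (φ.smulRight y) = (A φ).smulRight (B y)) → B y₀ = v₀ := by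
    intro φ B hφ hB
    obtain ⟨x₁, hx₁⟩ : ∃ x, A φ x = 1 := LinearMap.surjective (hA0 φ hφ) 1
    have := LinearMap.congr_fun ((hB y₀).symm.trans (hA φ)) x₁
    simpa [hx₁] using this
  have key : ∀ (φ : Dual K X) (y : Y), h (φ.smulRight y) = (A φ).smulRight (b y) := by
    intro φ y
    by_cases hφ : φ = 0
    · subst hφ
      have : (0 : Dual K X).smulRight y = 0 := by ext; simp
      rw [this, map_zero, map_zero]
      ext; simp
    obtain ⟨B, hB⟩ := hB φ hφ
    obtain ⟨c, rfl⟩ : ∃ c : K, B = c • b := by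
      refine LinearMap.exists_eq_smul_of_forall_apply_eq_smul hbinj fun y => ?_
      by_cases hy : y = 0
      · exact ⟨0, by simp [hy]⟩
      obtain ⟨v, hv⟩ := hrange' y
      obtain ⟨x₁, hx₁⟩ : ∃ x, A φ x = 1 := LinearMap.surjective (hA0 φ hφ) 1
      obtain ⟨x₂, hx₂⟩ : ∃ x, A φ₀ x = 1 := LinearMap.surjective (hA0 φ₀ hφ₀) 1
      obtain ⟨c₁, hc₁⟩ := hv φ x₁
      obtain ⟨c₂, hc₂⟩ := hv φ₀ x₂
      rw [hB, LinearMap.smulRight_apply, hx₁, one_smul] at hc₁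
      rw [hb, LinearMap.smulRight_apply, hx₂, one_smul] at hc₂
      have hc₂0 : c₂ ≠ 0 := by
        rintro rfl
        exact hb0 y hy (by rw [hc₂, zero_smul])
      exact ⟨c₁ / c₂, by rw [hc₁, hc₂, smul_smul, div_mul_cancel₀ _ hc₂0]⟩
    have hc : c = 1 := by
      have h1 := apply_y₀ φ _ hφ hB
      rw [LinearMap.smul_apply, apply_y₀ φ₀ b hφ₀ hb] at h1
      exact smul_left_injective K hv₀0 (by simpa using h1)
    rw [hB, hc, one_smul]
  let b' := LinearEquiv.ofInjectiveEndo b hbinj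
  have hb' : ∀ y, b' y = b y := fun _ => rfl
  refine ⟨a, b', fun f => ?_⟩
  let S : (X →ₗ[K] Y) →ₗ[K] (X →ₗ[K] Y) :=
    { toFun := fun f => b'.toLinearMap ∘ₗ f ∘ₗ a.toLinearMap
      map_add' := fun f g => by ext; simp
      map_smul' := fun c f => by ext; simp }
  have hS : h = S := LinearMap.ext_smulRight fun φ y => by
    rw [key]
    ext x
    simp [S, ha, hb']
  exact LinearMap.congr_fun hS f

end Helpers



/-- A linear transformation of `Hom_K(X,Y)` preserving the type
`β(L) = (dim X − dim Ker L, dim im L)` of every subspace `L` has the form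
`f ↦ b ∘ f ∘ a` for some automorphisms `a` of `X` and `b` of `Y`. -/
theorem type_preserving_is_sandwich (K X Y : Type*) [Field K]
    [AddCommGroup X] [Module K X] [AddCommGroup Y] [Module K Y]
    [FiniteDimensional K X] [FiniteDimensional K Y]
    (h : (X →ₗ[K] Y) →ₗ[K] (X →ₗ[K] Y))
    (hβ : ∀ L : Submodule K (X →ₗ[K] Y),
      (finrank K X - finrank K ↥(⨅ f ∈ L.map h, LinearMap.ker f),
        finrank K ↥(⨆ f ∈ L.map h, LinearMap.range f)) =
      (finrank K X - finrank K ↥(⨅ f ∈ L, LinearMap.ker f),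
        finrank K ↥(⨆ f ∈ L, LinearMap.range f))) :
    ∃ (a : X ≃ₗ[K] X) (b : Y ≃ₗ[K] Y),
      ∀ f : X →ₗ[K] Y, h f = b.toLinearMap ∘ₗ f ∘ₗ a.toLinearMap := by
  have hk := fun L => (Prod.mk.inj (hβ L)).1
  have hr := fun L => (Prod.mk.inj (hβ L)).2
  refine LinearMap.exists_sandwich_of_injective h ?_ ?_ ?_
  · refine (injective_iff_map_eq_zero h).2 fun f hf => ?_
    have h1 := hr (K ∙ f)
    rw [Submodule.map_span, Set.image_singleton, hf, Submodule.span_zero_singleton] at h1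
    have h0 : ⨆ g ∈ (⊥ : Submodule K (X →ₗ[K] Y)), LinearMap.range g = ⊥ := by simp
    rw [h0, finrank_bot] at h1
    have h2 := Submodule.finrank_eq_zero.1 h1.symm
    rw [← LinearMap.range_eq_bot, eq_bot_iff, ← h2]
    exact le_iSup₂_of_le f (Submodule.mem_span_singleton_self f) le_rfl
  · intro y
    let L : Submodule K (X →ₗ[K] Y) :=
      Submodule.span K (Set.range fun φ : Dual K X => φ.smulRight y)
    have hL : ⨆ f ∈ L, LinearMap.range f ≤ K ∙ y := by
      refine iSup₂_le fun f hf => ?_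
      rintro _ ⟨x, rfl⟩
      induction hf using Submodule.span_induction with
      | mem f hf =>
        obtain ⟨φ, rfl⟩ := hf
        exact Submodule.mem_span_singleton.2 ⟨φ x, rfl⟩
      | zero => simp
      | add f g _ _ hf hg => exact add_mem hf hg
      | smul c f _ hf => exact Submodule.smul_mem _ c hf
    obtain ⟨v, hv⟩ := Submodule.exists_le_span_singleton_of_finrank_le_one _
      ((hr L).trans_le ((Submodule.finrank_mono hL).trans (by simpa using finrank_span_le_card (R := K) {y})))
    refine ⟨v, fun φ => le_trans ?_ hv⟩
    have hφ : φ.smulRight y ∈ L := Submodule.subset_span ⟨φ, rfl⟩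
    exact le_iSup₂_of_le (h (φ.smulRight y)) (Submodule.mem_map_of_mem hφ) le_rfl
  · intro φ
    let L : Submodule K (X →ₗ[K] Y) := LinearMap.range (LinearMap.smulRightₗ (M := Y) φ)
    have hL : LinearMap.ker φ ≤ ⨅ f ∈ L, LinearMap.ker f := by
      refine le_iInf₂ fun f hf x hx => ?_
      obtain ⟨y, rfl⟩ := hf
      simp [LinearMap.mem_ker.1 hx]
    obtain ⟨ψ, hψ⟩ := Submodule.exists_ker_le_of_finrank_sub_le_one _ ((hk L).trans_le (by
      have h1 := Submodule.finrank_mono hL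
      have h2 := LinearMap.finrank_range_add_finrank_ker φ
      have h3 := (LinearMap.range φ).finrank_le
      rw [finrank_self] at h3
      omega))
    exact ⟨ψ, fun y => hψ.trans (iInf₂_le_of_le (h (φ.smulRight y))
      (Submodule.mem_map_of_mem ⟨y, rfl⟩) le_rfl)⟩
end

section
/- Let G be a group containing elements a_1, a_2, a_3, a_4 such that: (1) G is generated by a_1, a_2, a_3, a_4; (2) the relations a_1² = a_2² = a_3² = a_4³ = 1, a_1 a_2 = a_2 a_1, a_3 a_1 a_3 = a_1 a_2, a_3 a_2 a_3 = a_2, a_4 a_1 a_4⁻¹ = a_1 a_2, a_4 a_2 a_4⁻¹ = a_1, and a_3 a_4 a_3 = a_4⁻¹ hold; and (3) a_1 ≠ 1. Then G is isomorphic to the symmetric group S_4 on four letters. -/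
/-- The relations satisfied by `a₁, a₂, a₃, a₄`. -/
structure S4Relations {G : Type*} [Group G] (a₁ a₂ a₃ a₄ : G) : Prop where
  sq₁ : a₁ ^ 2 = 1
  sq₂ : a₂ ^ 2 = 1
  sq₃ : a₃ ^ 2 = 1
  cube₄ : a₄ ^ 3 = 1
  comm₁₂ : a₁ * a₂ = a₂ * a₁
  conj₃₁ : a₃ * a₁ * a₃ = a₁ * a₂
  conj₃₂ : a₃ * a₂ * a₃ = a₂
  conj₄₁ : a₄ * a₁ * a₄⁻¹ = a₁ * a₂
  conj₄₂ : a₄ * a₂ * a₄⁻¹ = a₁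
  conj₃₄ : a₃ * a₄ * a₃ = a₄⁻¹

namespace S4Relations

variable {G H : Type*} [Group G] [Group H] {a₁ a₂ a₃ a₄ : G} {b₁ b₂ b₃ b₄ : H}

theorem prod (ha : S4Relations a₁ a₂ a₃ a₄) (hb : S4Relations b₁ b₂ b₃ b₄) :
    S4Relations (a₁, b₁) (a₂, b₂) (a₃, b₃) (a₄, b₄) where
  sq₁ := Prod.ext ha.sq₁ hb.sq₁
  sq₂ := Prod.ext ha.sq₂ hb.sq₂
  sq₃ := Prod.ext ha.sq₃ hb.sq₃
  cube₄ := Prod.ext ha.cube₄ hb.cube₄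
  comm₁₂ := Prod.ext ha.comm₁₂ hb.comm₁₂
  conj₃₁ := Prod.ext ha.conj₃₁ hb.conj₃₁
  conj₃₂ := Prod.ext ha.conj₃₂ hb.conj₃₂
  conj₄₁ := Prod.ext ha.conj₄₁ hb.conj₄₁
  conj₄₂ := Prod.ext ha.conj₄₂ hb.conj₄₂
  conj₃₄ := Prod.ext ha.conj₃₄ hb.conj₃₄

theorem exists_normal_form (h : S4Relations a₁ a₂ a₃ a₄) {x : G}
    (hx : x ∈ Subgroup.closure {a₁, a₂, a₃, a₄}) :
    ∃ i j k l : ℕ, a₁ ^ i * a₂ ^ j * a₄ ^ k * a₃ ^ l = x := by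
  have hc : Commute a₁ a₂ := h.comm₁₂
  have inv₃ : a₃⁻¹ = a₃ := inv_eq_of_mul_eq_one_left (by rw [← sq, h.sq₃])
  have left₁ (x : G) : (∃ i j k l : ℕ, a₁ ^ i * a₂ ^ j * a₄ ^ k * a₃ ^ l = x) →
      ∃ i j k l : ℕ, a₁ ^ i * a₂ ^ j * a₄ ^ k * a₃ ^ l = a₁ * x := by
    rintro ⟨i, j, k, l, rfl⟩
    exact ⟨i + 1, j, k, l, by simp only [pow_succ', mul_assoc]⟩
  have left₂ (x : G) : (∃ i j k l : ℕ, a₁ ^ i * a₂ ^ j * a₄ ^ k * a₃ ^ l = x) →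
      ∃ i j k l : ℕ, a₁ ^ i * a₂ ^ j * a₄ ^ k * a₃ ^ l = a₂ * x := by
    rintro ⟨i, j, k, l, rfl⟩
    refine ⟨i, j + 1, k, l, ?_⟩
    simp only [pow_succ', ← mul_assoc, (hc.pow_left i).eq]
  have left₃ (x : G) : (∃ i j k l : ℕ, a₁ ^ i * a₂ ^ j * a₄ ^ k * a₃ ^ l = x) →
      ∃ i j k l : ℕ, a₁ ^ i * a₂ ^ j * a₄ ^ k * a₃ ^ l = a₃ * x := by
    rintro ⟨i, j, k, l, rfl⟩
    refine ⟨i, i + j, 2 * k, l + 1, ?_⟩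
    have e₁ : a₃ * a₁ ^ i * a₃⁻¹ = a₁ ^ i * a₂ ^ i := by
      rw [← conj_pow, inv₃, h.conj₃₁, hc.mul_pow]
    have e₂ : a₃ * a₂ ^ j * a₃⁻¹ = a₂ ^ j := by
      rw [← conj_pow, inv₃, h.conj₃₂]
    have inv₄ : a₄⁻¹ = a₄ ^ 2 := inv_eq_of_mul_eq_one_left (by rw [← pow_succ, h.cube₄])
    have e₄ : a₃ * a₄ ^ k * a₃⁻¹ = a₄ ^ (2 * k) := by
      rw [← conj_pow, inv₃, h.conj₃₄, inv₄, pow_mul]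
    calc _ = (a₁ ^ i * a₂ ^ i) * a₂ ^ j * a₄ ^ (2 * k) * (a₃ * a₃ ^ l) := by
          rw [pow_add, pow_succ']; simp only [mul_assoc]
      _ = _ := by rw [← e₁, ← e₄]; nth_rw 1 [← e₂]; group
  have left₄ (x : G) : (∃ i j k l : ℕ, a₁ ^ i * a₂ ^ j * a₄ ^ k * a₃ ^ l = x) →
      ∃ i j k l : ℕ, a₁ ^ i * a₂ ^ j * a₄ ^ k * a₃ ^ l = a₄ * x := by
    rintro ⟨i, j, k, l, rfl⟩
    refine ⟨i + j, i, k + 1, l, ?_⟩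
    have e₁ : a₄ * a₁ ^ i * a₄⁻¹ = a₁ ^ i * a₂ ^ i := by
      rw [← conj_pow, h.conj₄₁, hc.mul_pow]
    have e₂ : a₄ * a₂ ^ j * a₄⁻¹ = a₁ ^ j := by
      rw [← conj_pow, h.conj₄₂]
    calc _ = (a₁ ^ i * a₂ ^ i) * a₁ ^ j * (a₄ * a₄ ^ k) * a₃ ^ l := by
          rw [pow_add, pow_succ', mul_assoc (a₁ ^ i), (hc.pow_pow j i).eq]; simp only [mul_assoc]
      _ = _ := by rw [← e₁, ← e₂]; group
  induction hx using Subgroup.closure_induction_left with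
  | one => exact ⟨0, 0, 0, 0, by simp⟩
  | mul_left y hy z _ ih =>
    rcases hy with rfl | rfl | rfl | rfl
    exacts [left₁ _ ih, left₂ _ ih, left₃ _ ih, left₄ _ ih]
  | inv_mul_cancel y hy z _ ih =>
    rcases hy with rfl | rfl | rfl | rfl
    · rw [inv_eq_of_mul_eq_one_left (by rw [← sq, h.sq₁])]
      exact left₁ _ ih
    · rw [inv_eq_of_mul_eq_one_left (by rw [← sq, h.sq₂])]
      exact left₂ _ ih
    · rw [inv₃]
      exact left₃ _ ih
    · rw [inv_eq_of_mul_eq_one_left (a := y * y) (by rw [← h.cube₄, pow_three']), mul_assoc]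
      exact left₄ _ (left₄ _ ih)

theorem finite_closure_and_card_le (h : S4Relations a₁ a₂ a₃ a₄) :
    Finite (Subgroup.closure {a₁, a₂, a₃, a₄}) ∧
      Nat.card (Subgroup.closure {a₁, a₂, a₃, a₄}) ≤ 24 := by
  let f : Fin 2 × Fin 2 × Fin 3 × Fin 2 → G := fun t ↦
    a₁ ^ t.1.val * a₂ ^ t.2.1.val * a₄ ^ t.2.2.1.val * a₃ ^ t.2.2.2.val
  have hsub : (Subgroup.closure {a₁, a₂, a₃, a₄} : Set G) ⊆ Set.range f := by
    intro x hx
    obtain ⟨i, j, k, l, rfl⟩ := h.exists_normal_form hx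
    refine ⟨(Fin.ofNat 2 i, Fin.ofNat 2 j, Fin.ofNat 3 k, Fin.ofNat 2 l), ?_⟩
    simp only [f, Fin.ofNat, ← pow_eq_pow_mod _ h.sq₁, ← pow_eq_pow_mod _ h.sq₂,
      ← pow_eq_pow_mod _ h.sq₃, ← pow_eq_pow_mod _ h.cube₄]
  refine ⟨(Set.finite_range f).subset hsub, ?_⟩
  calc _ ≤ Nat.card (Set.range f) := Nat.card_mono (Set.finite_range f) hsub
    _ ≤ Nat.card (Fin 2 × Fin 2 × Fin 3 × Fin 2) := Finite.card_range_le f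
    _ = 24 := by simp

end S4Relations

open Equiv in
theorem s4Relations_perm : S4Relations (swap 0 1 * swap 2 3 : Perm (Fin 4))
    (swap 0 2 * swap 1 3) (swap 1 3) (swap 1 3 * swap 3 2) := by
  constructor <;> decide

open Equiv in
theorem closure_perm_fin_four : Subgroup.closure {(swap 0 1 * swap 2 3 : Perm (Fin 4)),
    swap 0 2 * swap 1 3, swap 1 3, swap 1 3 * swap 3 2} = ⊤ := by
  have key : ∀ σ : Perm (Fin 4), ∃ i j l : Fin 2, ∃ k : Fin 3,
      (swap 0 1 * swap 2 3) ^ i.val * (swap 0 2 * swap 1 3) ^ j.val *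
        (swap 1 3 * swap 3 2) ^ k.val * (swap 1 3) ^ l.val = σ := by decide
  refine eq_top_iff.2 fun σ _ ↦ ?_
  obtain ⟨i, j, l, k, rfl⟩ := key σ
  refine mul_mem (mul_mem (mul_mem ?_ ?_) ?_) ?_ <;>
    exact pow_mem (Subgroup.subset_closure (by simp)) _

open scoped commutatorElement

set_option maxRecDepth 10000 in
open Equiv in
theorem exists_commutator_eq_swap_mul_swap : ∀ σ : Perm (Fin 4), σ ≠ 1 →
    ∃ τ ρ : Perm (Fin 4), ⁅⁅σ, τ⁆, ρ⁆ = swap 0 1 * swap 2 3 := by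
  have key : ∀ σ : Perm (Fin 4), σ ≠ 1 →
      ∃ τ ∈ [swap 1 2, swap 1 2 * swap 2 3],
      ∃ ρ ∈ [swap 2 3, swap 0 2 * swap 1 3, swap 0 3 * swap 1 2],
        σ * τ * σ⁻¹ * τ⁻¹ * ρ * (σ * τ * σ⁻¹ * τ⁻¹)⁻¹ * ρ⁻¹ = swap 0 1 * swap 2 3 := by
    decide
  intro σ hσ
  obtain ⟨τ, -, ρ, -, h⟩ := key σ hσ
  exact ⟨τ, ρ, h⟩

/-- A group generated by four elements satisfying the given relations, with `a₁ ≠ 1`,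
is isomorphic to the symmetric group `S₄`. -/
theorem group_with_relations_iso_S4 (G : Type*) [Group G] (a₁ a₂ a₃ a₄ : G)
    (hgen : Subgroup.closure {a₁, a₂, a₃, a₄} = ⊤)
    (h₁ : a₁ ^ 2 = 1) (h₂ : a₂ ^ 2 = 1) (h₃ : a₃ ^ 2 = 1) (h₄ : a₄ ^ 3 = 1)
    (h₁₂ : a₁ * a₂ = a₂ * a₁)
    (h₃₁₃ : a₃ * a₁ * a₃ = a₁ * a₂)
    (h₃₂₃ : a₃ * a₂ * a₃ = a₂)
    (h₄₁ : a₄ * a₁ * a₄⁻¹ = a₁ * a₂)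
    (h₄₂ : a₄ * a₂ * a₄⁻¹ = a₁)
    (h₃₄₃ : a₃ * a₄ * a₃ = a₄⁻¹)
    (hne : a₁ ≠ 1) :
    Nonempty (G ≃* Equiv.Perm (Fin 4)) := by
  have ha : S4Relations a₁ a₂ a₃ a₄ := ⟨h₁, h₂, h₃, h₄, h₁₂, h₃₁₃, h₃₂₃, h₄₁, h₄₂, h₃₄₃⟩
  obtain ⟨hfin, hcard⟩ := (ha.prod s4Relations_perm).finite_closure_and_card_le
  set R := Subgroup.closure {(a₁, (Equiv.swap 0 1 * Equiv.swap 2 3 : Equiv.Perm (Fin 4))),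
    (a₂, Equiv.swap 0 2 * Equiv.swap 1 3), (a₃, Equiv.swap 1 3),
    (a₄, Equiv.swap 1 3 * Equiv.swap 3 2)} with hR
  let p : R →* G := (MonoidHom.fst G _).comp R.subtype
  let q : R →* Equiv.Perm (Fin 4) := (MonoidHom.snd G _).comp R.subtype
  have hp : Function.Surjective p := by
    rw [← MonoidHom.range_eq_top, MonoidHom.range_comp, Subgroup.range_subtype, hR,
      MonoidHom.map_closure]
    simpa [Set.image_insert_eq] using hgen
  have hq : Function.Surjective q := by
    rw [← MonoidHom.range_eq_top, MonoidHom.range_comp, Subgroup.range_subtype, hR,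
      MonoidHom.map_closure]
    simpa [Set.image_insert_eq] using closure_perm_fin_four
  have hq' : Function.Bijective q := by
    refine hq.bijective_of_nat_card_le ?_
    rwa [Nat.card_perm, Nat.card_fin]
  have hp' : Function.Injective p := by
    refine (injective_iff_map_eq_one p).2 fun x hx ↦ ?_
    by_contra hx1
    obtain ⟨τ, ρ, h⟩ := exists_commutator_eq_swap_mul_swap (q x)
      fun h ↦ hx1 (hq'.1 (h.trans (map_one q).symm))
    obtain ⟨y, rfl⟩ := hq τ
    obtain ⟨z, rfl⟩ := hq ρ
    let r : R := ⟨(a₁, Equiv.swap 0 1 * Equiv.swap 2 3), Subgroup.subset_closure (by simp)⟩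
    have hr : ⁅⁅x, y⁆, z⁆ = r :=
      hq'.1 (by rw [map_commutatorElement, map_commutatorElement, h]; rfl)
    refine hne (show p r = 1 from ?_)
    rw [← hr, map_commutatorElement, map_commutatorElement, hx]
    simp
  exact ⟨(MulEquiv.ofBijective p ⟨hp', hp⟩).symm.trans (MulEquiv.ofBijective q hq')⟩
end
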